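/- Let k, m, n be positive integers, r an integer, and γ ∈ Γ^J. Write O_k ψ = D_τψ − (k/12)E₂ψ − J₁D_zψ + mJ₂ψ. Then for every (τ,z) ∈ D' such that γ·(τ,z) ∈ D', ((O_k(q^nζ^r))|_{k+2,m}γ)(τ,z) = (O_k((q^nζ^r)|_{k,m}γ))(τ,z). -/

import Mathlib

noncomputable section

open Complex MeasureTheory Set
open scoped ComplexConjugate

/-- `e w = exp (2 π i w)`. -/
def e (w : ℂ) : ℂ := Complex.exp (2 * (Real.pi : ℂ) * Complex.I * w)

/-- The monomial `q^n ζ^r`, i.e. `(τ, z) ↦ e^{2πi(nτ + rz)}`. -/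
def Qmon (n : ℕ) (r : ℤ) (τ z : ℂ) : ℂ := e ((n : ℂ) * τ + (r : ℂ) * z)

/-- `σ₁(n)`, the sum of the positive divisors of `n`. -/
def sigma1 (n : ℕ) : ℕ := ∑ d ∈ n.divisors, d

/-- The weight-2 Eisenstein series `E₂(τ) = 1 - 24 ∑_{n ≥ 1} σ₁(n) e^{2πinτ}`. -/
def E2 (τ : ℂ) : ℂ := 1 - 24 * ∑' n : ℕ, (sigma1 (n + 1) : ℂ) * e (((n : ℂ) + 1) * τ)

/-- The deformed Eisenstein series
`J₁(τ,z) = ζ/(ζ-1) - 1/2 - ∑_{a,b ≥ 1} (ζ^a - ζ^{-a}) q^{ab}`. -/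
def J1 (τ z : ℂ) : ℂ :=
  e z / (e z - 1) - 1 / 2 -
    ∑' p : ℕ × ℕ, (e (((p.1 : ℂ) + 1) * z) - e (-(((p.1 : ℂ) + 1) * z))) *
      e (((p.1 : ℂ) + 1) * ((p.2 : ℂ) + 1) * τ)

/-- The deformed Eisenstein series
`J₂(τ,z) = 1/6 - 2 ∑_{a,b ≥ 1} b (ζ^a + ζ^{-a}) q^{ab}`. -/
def J2 (τ z : ℂ) : ℂ :=
  1 / 6 - 2 * ∑' p : ℕ × ℕ, ((p.2 : ℂ) + 1) *
      (e (((p.1 : ℂ) + 1) * z) + e (-(((p.1 : ℂ) + 1) * z))) *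
      e (((p.1 : ℂ) + 1) * ((p.2 : ℂ) + 1) * τ)

/-- `D_τ = (1/2πi) ∂/∂τ`. -/
def Dt (φ : ℂ → ℂ → ℂ) : ℂ → ℂ → ℂ :=
  fun τ z => (1 / (2 * (Real.pi : ℂ) * Complex.I)) * deriv (fun t => φ t z) τ

/-- `D_z = (1/2πi) ∂/∂z`. -/
def Dz (φ : ℂ → ℂ → ℂ) : ℂ → ℂ → ℂ :=
  fun τ z => (1 / (2 * (Real.pi : ℂ) * Complex.I)) * deriv (fun w => φ τ w) z

/-- The slash action `φ ↦ φ|_{k,m} γ` for `γ = ((a,b;c,d),(λ,μ)) ∈ Γ^J`. -/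
def slash (k m : ℤ) (a b c d lam mu : ℤ) (φ : ℂ → ℂ → ℂ) (τ z : ℂ) : ℂ :=
  ((c : ℂ) * τ + (d : ℂ)) ^ (-k) *
    e ((m : ℂ) * (-(c : ℂ) * (z + (lam : ℂ) * τ + (mu : ℂ)) ^ 2 / ((c : ℂ) * τ + (d : ℂ)) +
        (lam : ℂ) ^ 2 * τ + 2 * (lam : ℂ) * z)) *
    φ (((a : ℂ) * τ + (b : ℂ)) / ((c : ℂ) * τ + (d : ℂ)))
      ((z + (lam : ℂ) * τ + (mu : ℂ)) / ((c : ℂ) * τ + (d : ℂ)))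

/-- The domain `D' = {(τ,z) : 0 < Im τ, |Im z| < Im τ, e^{2πiz} ≠ 1}`. -/
def D' : Set (ℂ × ℂ) := {p | 0 < p.1.im ∧ |p.2.im| < p.1.im ∧ e p.2 ≠ 1}

/-- The Oberdieck derivative `Oφ = D_τφ - (k/12)E₂φ - J₁D_zφ + mJ₂φ` of weight `k`, index `m`. -/
def Ober (k m : ℕ) (φ : ℂ → ℂ → ℂ) : ℂ → ℂ → ℂ :=
  fun τ z => Dt φ τ z - ((k : ℂ) / 12) * E2 τ * φ τ z - J1 τ z * Dz φ τ z +
    (m : ℂ) * J2 τ z * φ τ z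

/-- The heat operator `L_m = 4m D_τ - D_z²`. -/
def Heat (m : ℕ) (φ : ℂ → ℂ → ℂ) : ℂ → ℂ → ℂ :=
  fun τ z => 4 * (m : ℂ) * Dt φ τ z - Dz (Dz φ) τ z

/-- The modified heat operator `L_{k,m} = L_m - (m(2k-1)/6) E₂`. -/
def HeatE (k m : ℕ) (φ : ℂ → ℂ → ℂ) : ℂ → ℂ → ℂ :=
  fun τ z => Heat m φ τ z - (m : ℂ) * (2 * (k : ℂ) - 1) / 6 * E2 τ * φ τ z

/-- The Jacobi–Serre derivative of weight `k` and index `m`. -/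
def JSerre (k m : ℕ) (φ : ℂ → ℂ → ℂ) : ℂ → ℂ → ℂ :=
  fun τ z => Dt φ τ z - ((k : ℂ) / 12) * E2 τ * φ τ z +
    (1 / (1 - 4 * (m : ℂ))) *
      (Dz (Dz φ) τ z - J1 τ z * Dz φ τ z + (m : ℂ) * J2 τ z * φ τ z -
        ((m : ℂ) / 6) * E2 τ * φ τ z)

/-- The error function `erf a = (2/√π) ∫₀^a e^{-t²} dt`. -/
def erf (a : ℝ) : ℝ := 2 / Real.sqrt Real.pi * ∫ t in (0 : ℝ)..a, Real.exp (-t ^ 2)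

/-- Euler's integral for `₂F₁(1/2, k+1; 3/2; x)`:
`F_k(x) = (1/2) ∫₀¹ t^{-1/2} (1 - xt)^{-(k+1)} dt`. -/
def Fk (k x : ℝ) : ℝ := (1 / 2) * ∫ t in (0 : ℝ)..1, t ^ (-(1 : ℝ) / 2) * (1 - x * t) ^ (-(k + 1))

/-- The integration region `(u,v,x,y) ∈ [0,1] × (0,∞) × [0,1] × ℝ`. -/
def Reg : Set (ℝ × ℝ × ℝ × ℝ) := Icc 0 1 ×ˢ Ioi 0 ×ˢ Icc 0 1 ×ˢ univ

/-- The Fourier series `φ(τ,z) = ∑_{n,r} c(n,r) q^n ζ^r`. -/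
def phiF (c : ℕ → ℤ → ℂ) (τ z : ℂ) : ℂ :=
  ∑' p : ℕ × ℤ, c p.1 p.2 * e ((p.1 : ℂ) * τ + (p.2 : ℂ) * z)

open Filter Topology

lemma e_add (x y : ℂ) : e (x + y) = e x * e y := by
  simp only [e, mul_add, Complex.exp_add]

lemma e_ne_zero (x : ℂ) : e x ≠ 0 := Complex.exp_ne_zero _

@[simp] lemma e_zero : e 0 = 1 := by simp [e]

lemma e_neg (x : ℂ) : e (-x) = (e x)⁻¹ := by
  simp only [e, mul_neg, Complex.exp_neg]

lemma e_natCast_mul (n : ℕ) (x : ℂ) : e (n * x) = e x ^ n := by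
  simp only [e]
  rw [← Complex.exp_nat_mul]
  ring_nf

lemma e_eq_one_iff (x : ℂ) : e x = 1 ↔ ∃ n : ℤ, x = n := by
  have h : (2 * (Real.pi : ℂ) * Complex.I) ≠ 0 := Complex.two_pi_I_ne_zero
  rw [e, Complex.exp_eq_one_iff]
  refine exists_congr fun n => ?_
  rw [mul_comm (n : ℂ), mul_right_inj' h]

@[simp] lemma e_intCast (n : ℤ) : e n = 1 := (e_eq_one_iff _).2 ⟨n, rfl⟩

lemma norm_e (x : ℂ) : ‖e x‖ = Real.exp (-(2 * Real.pi * x.im)) := by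
  rw [e, Complex.norm_exp]
  simp

lemma norm_e_lt_one {x : ℂ} (hx : 0 < x.im) : ‖e x‖ < 1 := by
  rw [norm_e, Real.exp_lt_one_iff]
  have := Real.pi_pos
  simp only [Left.neg_neg_iff]
  positivity

lemma hasDerivAt_e (x : ℂ) : HasDerivAt e (2 * (Real.pi : ℂ) * Complex.I * e x) x := by
  have h := ((hasDerivAt_id x).const_mul (2 * (Real.pi : ℂ) * Complex.I)).cexp
  rw [mul_one, mul_comm (cexp _)] at h
  exact h

lemma differentiable_e : Differentiable ℂ e := fun x => (hasDerivAt_e x).differentiableAt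

/-- The sum `x / (1 - x)` of the geometric series `∑_{a ≥ 1} x ^ a`. -/
def geomFrac (x : ℂ) : ℂ := x / (1 - x)

lemma geomFrac_add_geomFrac_inv {x : ℂ} (h0 : x ≠ 0) (h1 : x ≠ 1) :
    geomFrac x + geomFrac x⁻¹ = -1 := by
  have h2 : 1 - x ≠ 0 := sub_ne_zero.2 h1.symm
  have h3 : x - 1 ≠ 0 := sub_ne_zero.2 h1
  have h4 : geomFrac x⁻¹ = 1 / (x - 1) := by
    rw [geomFrac, eq_div_iff h3, div_mul_eq_mul_div, div_eq_iff]
    · field_simp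
    · intro h
      apply h1
      rw [sub_eq_zero] at h
      exact (inv_eq_one.1 h.symm)
  rw [h4, geomFrac, ← neg_sub x 1, div_neg, neg_add_eq_sub, ← sub_div, ← neg_sub x 1, neg_div,
    div_self h3]

lemma hasSum_geomFrac {x : ℂ} (hx : ‖x‖ < 1) : HasSum (fun a : ℕ => x ^ (a + 1)) (geomFrac x) := by
  simpa [pow_succ', geomFrac, div_eq_mul_inv] using (hasSum_geometric_of_norm_lt_one hx).mul_left x

lemma norm_geomFrac_le {x : ℂ} {ρ : ℝ} (hx : ‖x‖ ≤ ρ) (hρ : ρ < 1) :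
    ‖geomFrac x‖ ≤ ‖x‖ / (1 - ρ) := by
  have h1 : 1 - ρ ≤ ‖1 - x‖ := by
    have := norm_sub_norm_le (1 : ℂ) x
    rw [norm_one] at this
    linarith
  rw [geomFrac, norm_div]
  gcongr

lemma differentiableAt_geomFrac {x : ℂ} (hx : x ≠ 1) : DifferentiableAt ℂ geomFrac x :=
  differentiableAt_id.div (differentiableAt_id.const_sub 1) (sub_ne_zero.2 hx.symm)

lemma summable_succ_mul_pow {ρ : ℝ} (h0 : 0 ≤ ρ) (h1 : ρ < 1) :
    Summable fun b : ℕ => ((b : ℝ) + 1) * ρ ^ b := by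
  have hρ : ‖ρ‖ < 1 := by rwa [Real.norm_of_nonneg h0]
  have h := (summable_pow_mul_geometric_of_norm_lt_one 1 hρ).add
    (summable_geometric_of_norm_lt_one hρ)
  refine h.congr fun b => ?_
  ring

/-- The weighted Lambert series `∑_{b ≥ 0} w(b) q^{b+1}ζ / (1 - q^{b+1}ζ)`. -/
def lambert (w : ℕ → ℂ) (τ z : ℂ) : ℂ :=
  ∑' b : ℕ, w b * geomFrac (e (((b : ℂ) + 1) * τ + z))

lemma e_succ_mul_add (b : ℕ) (τ z : ℂ) :
    e (((b : ℂ) + 1) * τ + z) = e τ ^ b * e (τ + z) := by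
  rw [← e_natCast_mul, ← e_add]
  ring_nf

lemma summable_lambert {w : ℕ → ℂ} (hw : ∀ b, ‖w b‖ ≤ b + 1) {τ : ℂ} (hτ : 0 < τ.im) (z : ℂ) :
    Summable fun b : ℕ => w b * geomFrac (e (((b : ℂ) + 1) * τ + z)) := by
  have hq := norm_e_lt_one hτ
  have hs := ((summable_succ_mul_pow (norm_nonneg (e τ)) hq).mul_left (2 * ‖e (τ + z)‖))
  refine Summable.of_norm_bounded_eventually_nat hs ?_
  have ht : Tendsto (fun b : ℕ => ‖e τ‖ ^ b * ‖e (τ + z)‖) atTop (𝓝 0) := by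
    simpa using (tendsto_pow_atTop_nhds_zero_of_lt_one (norm_nonneg _) hq).mul_const ‖e (τ + z)‖
  filter_upwards [ht.eventually (ge_mem_nhds (show (0 : ℝ) < 1 / 2 by norm_num))] with b hb
  have h1 : ‖e (((b : ℂ) + 1) * τ + z)‖ = ‖e τ‖ ^ b * ‖e (τ + z)‖ := by
    rw [e_succ_mul_add, norm_mul, norm_pow]
  have h2 := norm_geomFrac_le (h1.le.trans hb) (by norm_num)
  rw [h1] at h2
  rw [norm_mul]
  calc ‖w b‖ * ‖geomFrac (e (((b : ℂ) + 1) * τ + z))‖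
      ≤ (b + 1) * (‖e τ‖ ^ b * ‖e (τ + z)‖ / (1 - 1 / 2)) := by
        gcongr
        exact hw b
    _ = _ := by ring

lemma norm_e_add_le {τ z : ℂ} {t : ℝ} (hz : |z.im| ≤ t) :
    ‖e (τ + z)‖ ≤ Real.exp (-(2 * Real.pi * (τ.im - t))) := by
  rw [norm_e]
  have := Real.pi_pos
  have := (abs_le.1 hz).1
  gcongr
  rw [Complex.add_im]
  linarith

lemma exp_neg_two_pi_mul_lt_one {x : ℝ} (hx : 0 < x) : Real.exp (-(2 * Real.pi * x)) < 1 := by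
  rw [Real.exp_lt_one_iff]
  have := Real.pi_pos
  simp only [Left.neg_neg_iff]
  positivity

lemma differentiableAt_lambert {w : ℕ → ℂ} (hw : ∀ b, ‖w b‖ ≤ b + 1) {τ z : ℂ}
    (hz : |z.im| < τ.im) : DifferentiableAt ℂ (lambert w τ) z := by
  have hτ : 0 < τ.im := (abs_nonneg _).trans_lt hz
  obtain ⟨t, ht1, ht2⟩ := exists_between hz
  set ρ : ℝ := Real.exp (-(2 * Real.pi * (τ.im - t))) with hρ
  have hρ1 : ρ < 1 := exp_neg_two_pi_mul_lt_one (by linarith)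
  have hρ0 : 0 < ρ := Real.exp_pos _
  have hq := norm_e_lt_one hτ
  set U : Set ℂ := {x | |x.im| < t} with hU
  have hUo : IsOpen U := isOpen_lt (by fun_prop) continuous_const
  have hx : ∀ b : ℕ, ∀ x ∈ U, ‖e (((b : ℂ) + 1) * τ + x)‖ ≤ ‖e τ‖ ^ b * ρ := by
    intro b x hx
    rw [e_succ_mul_add, norm_mul, norm_pow]
    gcongr
    exact norm_e_add_le (le_of_lt hx)
  have hx' : ∀ b : ℕ, ∀ x ∈ U, ‖e (((b : ℂ) + 1) * τ + x)‖ ≤ ρ := fun b x h =>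
    (hx b x h).trans (mul_le_of_le_one_left hρ0.le (pow_le_one₀ (norm_nonneg _) hq.le))
  have hs := (summable_succ_mul_pow (norm_nonneg (e τ)) hq).mul_left (ρ / (1 - ρ))
  refine (Complex.differentiableOn_tsum_of_summable_norm hs (fun b x h => ?_) hUo
    (fun b x h => ?_)).differentiableAt (hUo.mem_nhds ht1)
  · refine (DifferentiableAt.const_mul ?_ _).differentiableWithinAt
    have h1 : e (((b : ℂ) + 1) * τ + x) ≠ 1 := by
      intro h1
      have := hx' b x h
      rw [h1, norm_one] at this
      linarith
    exact (differentiableAt_geomFrac h1).comp x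
      ((differentiable_e _).comp x (differentiableAt_id.const_add _))
  · have h2 := norm_geomFrac_le (hx' b x h) hρ1
    rw [norm_mul]
    calc ‖w b‖ * ‖geomFrac (e (((b : ℂ) + 1) * τ + x))‖
        ≤ (b + 1) * (‖e τ‖ ^ b * ρ / (1 - ρ)) := by
          gcongr
          · exact hw b
          · refine h2.trans ?_
            have : 0 < 1 - ρ := by linarith
            gcongr
            exact hx b x h
      _ = _ := by ring

lemma hasSum_lambert {w : ℕ → ℂ} (hw : ∀ b, ‖w b‖ ≤ b + 1) {τ z : ℂ} (hz : |z.im| < τ.im) :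
    HasSum (fun p : ℕ × ℕ => w p.2 * (e (((p.1 : ℂ) + 1) * z) *
      e (((p.1 : ℂ) + 1) * ((p.2 : ℂ) + 1) * τ))) (lambert w τ z) := by
  have hτ : 0 < τ.im := (abs_nonneg _).trans_lt hz
  set ρ : ℝ := Real.exp (-(2 * Real.pi * (τ.im - |z.im|))) with hρ
  have hρ1 : ρ < 1 := exp_neg_two_pi_mul_lt_one (by linarith)
  have hρ0 : 0 < ρ := Real.exp_pos _
  have hq := norm_e_lt_one hτ
  have hterm : ∀ a b : ℕ, e (((a : ℂ) + 1) * z) * e (((a : ℂ) + 1) * ((b : ℂ) + 1) * τ) =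
      e (((b : ℂ) + 1) * τ + z) ^ (a + 1) := by
    intro a b
    rw [← e_natCast_mul, ← e_add]
    push_cast
    ring_nf
  have hx : ∀ b : ℕ, ‖e (((b : ℂ) + 1) * τ + z)‖ ≤ ‖e τ‖ ^ b * ρ := by
    intro b
    rw [e_succ_mul_add, norm_mul, norm_pow]
    gcongr
    exact norm_e_add_le le_rfl
  have hx1 : ∀ b : ℕ, ‖e (((b : ℂ) + 1) * τ + z)‖ < 1 := fun b =>
    ((hx b).trans (mul_le_of_le_one_left hρ0.le (pow_le_one₀ (norm_nonneg _) hq.le))).trans_lt hρ1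
  rw [← (Equiv.prodComm ℕ ℕ).hasSum_iff]
  have hsum : Summable (fun p : ℕ × ℕ => w p.1 * e (((p.1 : ℂ) + 1) * τ + z) ^ (p.2 + 1)) := by
    have hρs : Summable fun a : ℕ => ρ ^ (a + 1) :=
      (summable_nat_add_iff 1).2 (summable_geometric_of_lt_one hρ0.le hρ1)
    have hs := (summable_succ_mul_pow (norm_nonneg (e τ)) hq).mul_of_nonneg hρs
      (fun b => by positivity) (fun a => by positivity)
    refine Summable.of_norm_bounded hs fun p => ?_
    rw [norm_mul, norm_pow, mul_assoc]
    gcongr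
    · exact hw _
    · calc ‖e (((p.1 : ℂ) + 1) * τ + z)‖ ^ (p.2 + 1) ≤ (‖e τ‖ ^ p.1 * ρ) ^ (p.2 + 1) := by
            gcongr
            exact hx _
        _ = (‖e τ‖ ^ p.1) ^ (p.2 + 1) * ρ ^ (p.2 + 1) := mul_pow _ _ _
        _ ≤ ‖e τ‖ ^ p.1 * ρ ^ (p.2 + 1) := by
            gcongr
            exact pow_le_of_le_one (by positivity) (pow_le_one₀ (norm_nonneg _) hq.le) (by simp)
  have hfun : ((fun p : ℕ × ℕ => w p.2 * (e (((p.1 : ℂ) + 1) * z) *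
      e (((p.1 : ℂ) + 1) * ((p.2 : ℂ) + 1) * τ))) ∘ (Equiv.prodComm ℕ ℕ)) =
      fun p : ℕ × ℕ => w p.1 * e (((p.1 : ℂ) + 1) * τ + z) ^ (p.2 + 1) := by
    funext p
    simp [hterm]
  rw [hfun]
  have h := hsum.hasSum.prod_fiberwise (fun b => (hasSum_geomFrac (hx1 b)).mul_left (w b))
  rw [lambert, h.tsum_eq]
  exact hsum.hasSum

/-- The meromorphic continuation in `z` of the deformed Eisenstein series `J1`. -/
def J1Ext (τ z : ℂ) : ℂ :=
  lambert (fun _ => 1) τ (-z) - lambert (fun _ => 1) τ z - 1 / 2 - geomFrac (e z)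

/-- The meromorphic continuation in `z` of the deformed Eisenstein series `J2`. -/
def J2Ext (τ z : ℂ) : ℂ :=
  1 / 6 - 2 * lambert (fun b => (b : ℂ) + 1) τ z - 2 * lambert (fun b => (b : ℂ) + 1) τ (-z)

/-- `z` does not lie on the lattice `ℤτ + ℤ`. -/
def OffLattice (τ z : ℂ) : Prop := ∀ l n : ℤ, z ≠ l * τ + n

lemma norm_one_le_succ (b : ℕ) : ‖(fun _ : ℕ => (1 : ℂ)) b‖ ≤ b + 1 := by
  simp

lemma norm_succ_le_succ (b : ℕ) : ‖(fun b : ℕ => (b : ℂ) + 1) b‖ ≤ b + 1 := by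
  have h : ((b : ℂ) + 1) = ((b + 1 : ℕ) : ℂ) := by push_cast; rfl
  simp only [h, Complex.norm_natCast]
  push_cast
  rfl

lemma OffLattice.e_ne_one {τ z : ℂ} (h : OffLattice τ z) : e z ≠ 1 := by
  intro h1
  obtain ⟨n, hn⟩ := (e_eq_one_iff z).1 h1
  exact h 0 n (by simp [hn])

lemma OffLattice.add {τ z : ℂ} (h : OffLattice τ z) (l n : ℤ) : OffLattice τ (z + l * τ + n) := by
  intro l' n' h'
  apply h (l' - l) (n' - n)
  push_cast
  linear_combination h'

lemma OffLattice.neg {τ z : ℂ} (h : OffLattice τ z) : OffLattice τ (-z) := by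
  intro l' n' h'
  apply h (-l') (-n')
  push_cast
  linear_combination -h'

lemma offLattice_of_mem {τ z : ℂ} (h : (τ, z) ∈ D') : OffLattice τ z := by
  obtain ⟨h1, h2, h3⟩ := h
  rintro l n rfl
  simp only [Complex.add_im, Complex.mul_im, Complex.intCast_re, Complex.intCast_im, zero_mul,
    add_zero, abs_mul] at h1 h2
  rw [abs_of_pos h1] at h2
  have h4 : |(l : ℝ)| < 1 := by
    by_contra! h4
    nlinarith
  have h5 : l = 0 := by
    rw [← Int.abs_lt_one_iff]
    exact_mod_cast h4
  apply h3
  simp [h5]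

lemma lambert_add_intCast (w : ℕ → ℂ) (τ z : ℂ) (n : ℤ) :
    lambert w τ (z + n) = lambert w τ z := by
  simp only [lambert, ← add_assoc, e_add _ (n : ℂ), e_intCast, mul_one]

lemma lambert_one_add {τ : ℂ} (hτ : 0 < τ.im) (z : ℂ) :
    lambert (fun _ => 1) τ (z + τ) = lambert (fun _ => 1) τ z - geomFrac (e (z + τ)) := by
  have h := (summable_lambert norm_one_le_succ hτ z).tsum_eq_zero_add
  simp only [lambert]
  rw [h, Nat.cast_zero, zero_add, one_mul, one_mul, add_comm τ z, add_sub_cancel_left]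
  refine tsum_congr fun b => ?_
  push_cast
  ring_nf

lemma lambert_succ_add {τ : ℂ} (hτ : 0 < τ.im) (z : ℂ) :
    lambert (fun b => (b : ℂ) + 1) τ (z + τ) =
      lambert (fun b => (b : ℂ) + 1) τ z - lambert (fun _ => 1) τ z := by
  have h1 := summable_lambert norm_one_le_succ hτ z
  have h2 := summable_lambert norm_succ_le_succ hτ z
  simp only [lambert]
  rw [← h2.tsum_sub h1, (h2.sub h1).tsum_eq_zero_add]
  simp only [Nat.cast_zero, zero_add, sub_self]
  refine tsum_congr fun b => ?_
  push_cast
  ring_nf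

lemma J1Ext_add_intCast (τ z : ℂ) (n : ℤ) : J1Ext τ (z + n) = J1Ext τ z := by
  have h : -(z + n) = -z + ((-n : ℤ) : ℂ) := by push_cast; ring
  simp only [J1Ext, h, lambert_add_intCast, e_add, e_intCast, mul_one]

lemma J2Ext_add_intCast (τ z : ℂ) (n : ℤ) : J2Ext τ (z + n) = J2Ext τ z := by
  have h : -(z + n) = -z + ((-n : ℤ) : ℂ) := by push_cast; ring
  simp only [J2Ext, h, lambert_add_intCast]

lemma J1Ext_add_tau {τ z : ℂ} (hτ : 0 < τ.im) (hz : OffLattice τ z) :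
    J1Ext τ (z + τ) = J1Ext τ z - 1 := by
  have h1 := lambert_one_add hτ z
  have h2 := lambert_one_add hτ (-(z + τ))
  have h3 : -(z + τ) + τ = -z := by ring
  rw [h3] at h2
  have h4 := geomFrac_add_geomFrac_inv (e_ne_zero z) hz.e_ne_one
  rw [← e_neg] at h4
  simp only [J1Ext]
  linear_combination -h1 - h2 + h4

lemma J2Ext_add_tau {τ z : ℂ} (hτ : 0 < τ.im) (hz : OffLattice τ z) :
    J2Ext τ (z + τ) = J2Ext τ z - 2 * J1Ext τ z + 1 := by
  have h1 := lambert_succ_add hτ z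
  have h2 := lambert_succ_add hτ (-(z + τ))
  have h5 := lambert_one_add hτ (-(z + τ))
  have h3 : -(z + τ) + τ = -z := by ring
  rw [h3] at h2 h5
  have h4 := geomFrac_add_geomFrac_inv (e_ne_zero z) hz.e_ne_one
  rw [← e_neg] at h4
  simp only [J2Ext, J1Ext]
  linear_combination -2 * h1 + 2 * h2 + 2 * h5 - 2 * h4

lemma J_ext_add_lattice {τ : ℂ} (hτ : 0 < τ.im) (l n : ℤ) : ∀ {z : ℂ}, OffLattice τ z →
    J1Ext τ (z + l * τ + n) = J1Ext τ z - l ∧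
      J2Ext τ (z + l * τ + n) = J2Ext τ z - 2 * l * J1Ext τ z + l ^ 2 := by
  simp only [J1Ext_add_intCast, J2Ext_add_intCast]
  induction l using Int.induction_on with
  | zero => simp
  | succ l ih =>
    intro z hz
    have hz' := hz.add l 0
    rw [Int.cast_zero, add_zero] at hz'
    have h : z + ((l + 1 : ℤ) : ℂ) * τ = z + (l : ℤ) * τ + τ := by push_cast; ring
    rw [h, J1Ext_add_tau hτ hz', J2Ext_add_tau hτ hz', (ih hz).1, (ih hz).2]
    push_cast
    constructor <;> ring
  | pred l ih =>
    intro z hz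
    have hz' := hz.add (-l - 1) 0
    rw [Int.cast_zero, add_zero] at hz'
    have h : z + ((-l : ℤ) : ℂ) * τ = z + ((-l - 1 : ℤ) : ℂ) * τ + τ := by push_cast; ring
    have h1 := (ih hz).1
    have h2 := (ih hz).2
    rw [h, J1Ext_add_tau hτ hz'] at h1
    rw [h, J2Ext_add_tau hτ hz'] at h2
    push_cast at h1 h2 ⊢
    have h3 : J1Ext τ (z + (-(l : ℂ) - 1) * τ) = J1Ext τ z - (-l - 1) := by
      linear_combination h1
    exact ⟨h3, by linear_combination h2 + 2 * h3⟩

lemma J1Ext_neg {τ z : ℂ} (hz : e z ≠ 1) : J1Ext τ (-z) = -J1Ext τ z := by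
  have h4 := geomFrac_add_geomFrac_inv (e_ne_zero z) hz
  rw [← e_neg] at h4
  simp only [J1Ext, neg_neg]
  linear_combination -h4

lemma J1_eq_J1Ext {τ z : ℂ} (h : |z.im| < τ.im) : J1 τ z = J1Ext τ z := by
  have h1 := hasSum_lambert norm_one_le_succ h
  have h2 := hasSum_lambert norm_one_le_succ (τ := τ) (z := -z) (by simpa using h)
  have h3 : e z / (e z - 1) = -geomFrac (e z) := by
    rw [geomFrac, ← neg_sub, div_neg]
  rw [J1, h3, J1Ext, ((h1.sub h2).congr_fun fun p => ?_).tsum_eq]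
  · ring
  · ring_nf

lemma J2_eq_J2Ext {τ z : ℂ} (h : |z.im| < τ.im) : J2 τ z = J2Ext τ z := by
  have h1 := hasSum_lambert norm_succ_le_succ h
  have h2 := hasSum_lambert norm_succ_le_succ (τ := τ) (z := -z) (by simpa using h)
  rw [J2, J2Ext, ((h1.add h2).congr_fun fun p => ?_).tsum_eq]
  · ring
  · ring_nf

lemma OffLattice.exists_shift_mem {τ z : ℂ} (hτ : 0 < τ.im) (hz : OffLattice τ z) :
    ∃ l : ℤ, (τ, z + l * τ) ∈ D' := by
  refine ⟨-⌊z.im / τ.im⌋, hτ, ?_, ?_⟩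
  · have h1 := Int.floor_le (z.im / τ.im)
    have h2 := Int.lt_floor_add_one (z.im / τ.im)
    rw [le_div_iff₀ hτ] at h1
    rw [div_lt_iff₀ hτ] at h2
    simp only [Int.cast_neg, neg_mul, Complex.add_im, Complex.neg_im, Complex.mul_im,
      Complex.intCast_re, Complex.intCast_im, zero_mul, add_zero]
    rw [abs_lt]
    constructor <;> linarith
  · have h := (hz.add (-⌊z.im / τ.im⌋) 0).e_ne_one
    simpa using h

lemma isOpen_fiber_D' (τ : ℂ) : IsOpen {w : ℂ | (τ, w) ∈ D'} := by
  by_cases hτ : 0 < τ.im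
  · have h : {w : ℂ | (τ, w) ∈ D'} = {w : ℂ | |w.im| < τ.im} ∩ {w : ℂ | e w ≠ 1} := by
      ext w
      simp [D', hτ]
    rw [h]
    exact (isOpen_lt (by fun_prop) continuous_const).inter
      (isOpen_ne_fun differentiable_e.continuous continuous_const)
  · have h : {w : ℂ | (τ, w) ∈ D'} = ∅ := by
      ext w
      simp [D', hτ]
    rw [h]
    exact isOpen_empty

lemma OffLattice.eventually {τ z : ℂ} (hτ : 0 < τ.im) (hz : OffLattice τ z) :
    ∀ᶠ w in 𝓝 z, OffLattice τ w := by
  obtain ⟨l, hl⟩ := hz.exists_shift_mem hτ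
  have hc : ContinuousAt (fun w : ℂ => w + l * τ) z := by fun_prop
  filter_upwards [hc.eventually ((isOpen_fiber_D' τ).mem_nhds hl)] with w hw
  have h := (offLattice_of_mem hw).add (-l) 0
  simpa using h

lemma eventually_offLattice_zero {τ : ℂ} (hτ : 0 < τ.im) : ∀ᶠ w in 𝓝[≠] 0, OffLattice τ w := by
  have h1 : ∀ᶠ w : ℂ in 𝓝[≠] 0, ‖w‖ < min 1 τ.im :=
    eventually_nhdsWithin_of_eventually_nhds
      ((continuous_norm.tendsto' (0 : ℂ) 0 norm_zero).eventually
        (gt_mem_nhds (lt_min one_pos hτ)))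
  filter_upwards [h1, self_mem_nhdsWithin] with w hw hw0
  refine offLattice_of_mem ⟨hτ, ?_, ?_⟩
  · exact (Complex.abs_im_le_norm w).trans_lt (hw.trans_le (min_le_right _ _))
  · intro h
    obtain ⟨n, rfl⟩ := (e_eq_one_iff w).1 h
    have h2 := hw.trans_le (min_le_left _ _)
    rw [Complex.norm_intCast] at h2
    have h3 : n = 0 := by
      rw [← Int.abs_lt_one_iff]
      exact_mod_cast h2
    exact hw0 (by simp [h3])

lemma differentiableAt_lambert_neg {w : ℕ → ℂ} (hw : ∀ b, ‖w b‖ ≤ b + 1) {τ z : ℂ}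
    (hz : |z.im| < τ.im) : DifferentiableAt ℂ (fun x => lambert w τ (-x)) z :=
  DifferentiableAt.comp z (g := lambert w τ)
    (differentiableAt_lambert hw (by simpa using hz)) differentiableAt_id.neg

lemma differentiableAt_J2Ext_of_strip {τ z : ℂ} (hz : |z.im| < τ.im) :
    DifferentiableAt ℂ (J2Ext τ) z :=
  (((differentiableAt_lambert norm_succ_le_succ hz).const_mul 2).const_sub (1 / 6)).sub
    ((differentiableAt_lambert_neg norm_succ_le_succ hz).const_mul 2)

lemma differentiableAt_lambert_part {τ z : ℂ} (hz : |z.im| < τ.im) :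
    DifferentiableAt ℂ
      (fun z => lambert (fun _ => 1) τ (-z) - lambert (fun _ => 1) τ z - 1 / 2) z :=
  ((differentiableAt_lambert_neg norm_one_le_succ hz).sub
    (differentiableAt_lambert norm_one_le_succ hz)).sub_const _

lemma differentiableAt_J1Ext_of_mem {τ z : ℂ} (hz : (τ, z) ∈ D') :
    DifferentiableAt ℂ (J1Ext τ) z :=
  (differentiableAt_lambert_part hz.2.1).sub
    (DifferentiableAt.comp z (differentiableAt_geomFrac hz.2.2) (differentiable_e z))

lemma differentiableAt_J1Ext {τ z : ℂ} (hτ : 0 < τ.im) (hz : OffLattice τ z) :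
    DifferentiableAt ℂ (J1Ext τ) z := by
  obtain ⟨l, hl⟩ := hz.exists_shift_mem hτ
  have h : DifferentiableAt ℂ (fun w => J1Ext τ (w + l * τ) + l) z :=
    (DifferentiableAt.comp z (f := fun w => w + l * τ) (differentiableAt_J1Ext_of_mem hl)
      (by fun_prop)).add_const _
  refine h.congr_of_eventuallyEq ?_
  filter_upwards [hz.eventually hτ] with w hw
  have h1 := (J_ext_add_lattice hτ l 0 hw).1
  rw [Int.cast_zero, add_zero] at h1
  rw [h1]
  ring

lemma differentiableAt_J2Ext {τ z : ℂ} (hτ : 0 < τ.im) (hz : OffLattice τ z) :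
    DifferentiableAt ℂ (J2Ext τ) z := by
  obtain ⟨l, hl⟩ := hz.exists_shift_mem hτ
  have h : DifferentiableAt ℂ (fun w => J2Ext τ (w + l * τ) + 2 * l * J1Ext τ w - l ^ 2) z :=
    ((DifferentiableAt.comp z (f := fun w => w + l * τ)
      (differentiableAt_J2Ext_of_strip hl.2.1) (by fun_prop)).add
      ((differentiableAt_J1Ext hτ hz).const_mul _)).sub_const _
  refine h.congr_of_eventuallyEq ?_
  filter_upwards [hz.eventually hτ] with w hw
  have h1 := (J_ext_add_lattice hτ l 0 hw).2
  rw [Int.cast_zero, add_zero] at h1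
  rw [h1]
  ring

lemma tendsto_mul_J1Ext {τ : ℂ} (hτ : 0 < τ.im) :
    Tendsto (fun z => z * J1Ext τ z) (𝓝[≠] 0) (𝓝 (2 * (Real.pi : ℂ) * Complex.I)⁻¹) := by
  have h1 : Tendsto (fun z => z *
      (lambert (fun _ => 1) τ (-z) - lambert (fun _ => 1) τ z - 1 / 2)) (𝓝[≠] 0) (𝓝 0) := by
    have h := (continuousAt_id (x := (0 : ℂ))).mul
      (differentiableAt_lambert_part (τ := τ) (z := 0) (by simpa using hτ)).continuousAt
    have h' := h.tendsto.mono_left (nhdsWithin_le_nhds (s := {0}ᶜ))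
    simpa using! h'
  have h2 : Tendsto (fun z => e z * (slope e 0 z)⁻¹) (𝓝[≠] 0)
      (𝓝 (2 * (Real.pi : ℂ) * Complex.I)⁻¹) := by
    have h := hasDerivAt_iff_tendsto_slope.1 (hasDerivAt_e 0)
    rw [e_zero, mul_one] at h
    have h' := (differentiable_e.continuous.tendsto 0).mono_left (nhdsWithin_le_nhds (s := {0}ᶜ))
    rw [e_zero] at h'
    simpa using h'.mul (h.inv₀ Complex.two_pi_I_ne_zero)
  have h3 := h1.add h2
  rw [zero_add] at h3
  refine h3.congr fun z => ?_
  rw [slope_def_field, e_zero, sub_zero, inv_div, J1Ext, geomFrac, ← neg_sub (e z) 1, div_neg]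
  ring

lemma tendsto_J2Ext_zero {τ : ℂ} (hτ : 0 < τ.im) :
    Tendsto (J2Ext τ) (𝓝[≠] 0) (𝓝 (J2Ext τ 0)) :=
  (differentiableAt_J2Ext_of_strip (by simpa using hτ)).continuousAt.tendsto.mono_left
    nhdsWithin_le_nhds

lemma exists_lattice_reduction {τ : ℂ} (hτ : 0 < τ.im) (z : ℂ) :
    ∃ l n : ℤ, ‖z + l * τ + n‖ ≤ ‖τ‖ + 1 := by
  set l : ℤ := ⌊z.im / τ.im⌋ with hl
  set s : ℝ := Int.fract (z.im / τ.im) with hs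
  set u : ℂ := z - l * τ - s * τ with hu
  have hu0 : u.im = 0 := by
    have h : (l : ℝ) + s = z.im / τ.im := Int.floor_add_fract _
    rw [eq_div_iff hτ.ne'] at h
    simp only [hu, Complex.sub_im, Complex.mul_im, Complex.intCast_re, Complex.intCast_im,
      zero_mul, add_zero, Complex.ofReal_re, Complex.ofReal_im]
    linarith
  have hu1 : u = (u.re : ℂ) := Complex.ext rfl (by simpa using hu0)
  refine ⟨-l, -⌊u.re⌋, ?_⟩
  have h : z + ((-l : ℤ) : ℂ) * τ + ((-⌊u.re⌋ : ℤ) : ℂ) = s * τ + (Int.fract u.re : ℝ) := by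
    have h2 : (u.re : ℂ) = (⌊u.re⌋ : ℂ) + (Int.fract u.re : ℝ) := by
      exact_mod_cast (Int.floor_add_fract u.re).symm
    push_cast
    rw [hu1.symm, hu] at h2
    linear_combination h2
  rw [h]
  refine (norm_add_le _ _).trans ?_
  rw [norm_mul, Complex.norm_real, Complex.norm_real, Real.norm_of_nonneg (Int.fract_nonneg _),
    Real.norm_of_nonneg (Int.fract_nonneg _)]
  have h3 := (Int.fract_lt_one (z.im / τ.im)).le
  have h4 := (Int.fract_lt_one u.re).le
  have h5 := norm_nonneg τ
  nlinarith

/-- A doubly periodic function, holomorphic off the lattice and `o(1 / z)` at `0`, is constant. -/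
lemma eq_const_of_doublyPeriodic {τ : ℂ} (hτ : 0 < τ.im) {h : ℂ → ℂ}
    (hd : ∀ z, OffLattice τ z → DifferentiableAt ℂ h z)
    (hp : ∀ z, OffLattice τ z → ∀ l n : ℤ, h (z + l * τ + n) = h z)
    (h0 : Tendsto (fun z => z * h z) (𝓝[≠] 0) (𝓝 0)) :
    ∃ L, Tendsto h (𝓝[≠] 0) (𝓝 L) ∧ ∀ z, OffLattice τ z → h z = L := by
  classical
  have hev := eventually_offLattice_zero hτ
  have hlim : ∃ L, Tendsto h (𝓝[≠] 0) (𝓝 L) := by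
    refine ⟨_, Complex.tendsto_limUnder_of_differentiable_on_punctured_nhds_of_isLittleO
      (hev.mono hd) ?_⟩
    refine Asymptotics.isLittleO_of_tendsto' ?_ ?_
    · filter_upwards [self_mem_nhdsWithin] with t ht ht'
      rw [inv_eq_zero, sub_zero] at ht'
      exact absurd ht' ht
    · have h1 : Tendsto (fun z : ℂ => z * h 0) (𝓝[≠] 0) (𝓝 0) := by
        have h2 : Continuous fun z : ℂ => z * h 0 := by fun_prop
        exact (h2.tendsto' 0 0 (zero_mul _)).mono_left nhdsWithin_le_nhds
      have h2 := h0.sub h1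
      rw [sub_zero] at h2
      refine h2.congr fun z => ?_
      rw [sub_zero, div_inv_eq_mul]
      ring
  obtain ⟨L, hL⟩ := hlim
  refine ⟨L, hL, ?_⟩
  set H : ℂ → ℂ := fun z => if OffLattice τ z then h z else L with hH
  have hHoff : ∀ z, OffLattice τ z → H z = h z := fun z hz => if_pos hz
  have hper : ∀ z, ∀ l n : ℤ, H (z + l * τ + n) = H z := by
    intro z l n
    by_cases hz : OffLattice τ z
    · rw [hHoff _ hz, hHoff _ (hz.add l n), hp z hz]
    · have hz' : ¬ OffLattice τ (z + l * τ + n) := by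
        intro h'
        apply hz
        have h'' := h'.add (-l) (-n)
        have : z + l * τ + n + ((-l : ℤ) : ℂ) * τ + ((-n : ℤ) : ℂ) = z := by push_cast; ring
        rwa [this] at h''
      simp only [hH, if_neg hz, if_neg hz']
  have hdoff : ∀ z, OffLattice τ z → DifferentiableAt ℂ H z := fun z hz =>
    (hd z hz).congr_of_eventuallyEq ((hz.eventually hτ).mono hHoff)
  have hH0 : H 0 = L := if_neg fun h => h 0 0 (by simp)
  have hd0 : DifferentiableAt ℂ H 0 := by
    refine (Complex.analyticAt_of_differentiable_on_punctured_nhds_of_continuousAt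
      (hev.mono hdoff) ?_).differentiableAt
    rw [continuousAt_iff_punctured_nhds, hH0]
    exact hL.congr' (hev.mono fun z hz => (hHoff z hz).symm)
  have hdiff : Differentiable ℂ H := by
    intro z
    by_cases hz : OffLattice τ z
    · exact hdoff z hz
    · simp only [OffLattice, not_forall, not_not] at hz
      obtain ⟨l, n, hz⟩ := hz
      have h1 : H = fun w => H (w + ((-l : ℤ) : ℂ) * τ + ((-n : ℤ) : ℂ)) :=
        funext fun w => (hper w (-l) (-n)).symm
      rw [h1]
      refine DifferentiableAt.comp z (g := H)
        (f := fun w => w + ((-l : ℤ) : ℂ) * τ + ((-n : ℤ) : ℂ)) ?_ (by fun_prop)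
      have h2 : z + ((-l : ℤ) : ℂ) * τ + ((-n : ℤ) : ℂ) = 0 := by rw [hz]; push_cast; ring
      rwa [h2]
  have hb : Bornology.IsBounded (Set.range H) := by
    refine ((isCompact_closedBall (0 : ℂ) (‖τ‖ + 1)).image hdiff.continuous).isBounded.subset ?_
    rintro _ ⟨z, rfl⟩
    obtain ⟨l, n, hln⟩ := exists_lattice_reduction hτ z
    exact ⟨_, by simpa using hln, hper z l n⟩
  intro z hz
  rw [← hHoff z hz, ← hH0]
  exact hdiff.apply_eq_apply_of_bounded hb z 0

lemma sigma1_eq (n : ℕ) : sigma1 n = ArithmeticFunction.sigma 1 n := by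
  simp [sigma1, ArithmeticFunction.sigma_one_apply]

lemma E2_eq_tsum_sigma (τ : ℂ) :
    E2 τ = 1 - 24 * ∑' n : ℕ+, (ArithmeticFunction.sigma 1 n : ℂ) * e τ ^ (n : ℕ) := by
  rw [E2, tsum_pnat_eq_tsum_succ (f := fun n : ℕ =>
    (ArithmeticFunction.sigma 1 n : ℂ) * e τ ^ n)]
  congr 2
  refine tsum_congr fun n => ?_
  rw [sigma1_eq, ← e_natCast_mul]
  push_cast
  rfl

lemma E2_eq_eisensteinSeries (τ : UpperHalfPlane) : E2 τ = EisensteinSeries.E2 τ := by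
  rw [E2_eq_tsum_sigma, EisensteinSeries.E2_eq_tsum_cexp]
  rfl

lemma J2Ext_zero {τ : ℂ} (hτ : 0 < τ.im) : J2Ext τ 0 = E2 τ / 6 := by
  have h := tsum_pow_div_one_sub_eq_tsum_sigma (norm_e_lt_one hτ) 1
  have h1 : lambert (fun b => (b : ℂ) + 1) τ 0 =
      ∑' n : ℕ+, (ArithmeticFunction.sigma 1 n : ℂ) * e τ ^ (n : ℕ) := by
    rw [← h, lambert, tsum_pnat_eq_tsum_succ (f := fun n : ℕ =>
      (n : ℂ) ^ 1 * e τ ^ n / (1 - e τ ^ n))]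
    refine tsum_congr fun b => ?_
    rw [← e_natCast_mul, geomFrac, add_zero]
    push_cast
    ring
  rw [J2Ext, neg_zero, h1, E2_eq_tsum_sigma]
  ring

section Modular

variable {a b c d : ℤ} {τ : ℂ}

lemma denom_ne_zero (hdet : a * d - b * c = 1) (hτ : 0 < τ.im) : (c : ℂ) * τ + d ≠ 0 := by
  intro h
  have h1 := congrArg Complex.im h
  have h2 := congrArg Complex.re h
  simp only [Complex.add_im, Complex.mul_im, Complex.intCast_re, Complex.intCast_im, zero_mul,
    add_zero, Complex.zero_im, mul_eq_zero, Int.cast_eq_zero, hτ.ne', or_false] at h1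
  subst h1
  simp only [Int.cast_zero, zero_mul, zero_add, Complex.intCast_re, Complex.zero_re,
    Int.cast_eq_zero] at h2
  subst h2
  simp at hdet

lemma E2_moebius (hdet : a * d - b * c = 1) (hτ : 0 < τ.im) :
    0 < (((a : ℂ) * τ + b) / (c * τ + d)).im ∧
    E2 (((a : ℂ) * τ + b) / (c * τ + d)) = (c * τ + d) ^ 2 * E2 τ +
      12 * c * (c * τ + d) * (2 * (Real.pi : ℂ) * Complex.I)⁻¹ := by
  have hj := denom_ne_zero hdet hτ
  set g : Matrix.SpecialLinearGroup (Fin 2) ℤ :=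
    ⟨!![a, b; c, d], by rw [Matrix.det_fin_two_of]; exact hdet⟩ with hg
  set t : UpperHalfPlane := ⟨τ, hτ⟩ with ht
  have hsmul : ((g • t : UpperHalfPlane) : ℂ) = ((a : ℂ) * τ + b) / (c * τ + d) := by
    rw [UpperHalfPlane.specialLinearGroup_apply]
    simp [hg, ht]
  have hden : UpperHalfPlane.denom g t = (c : ℂ) * τ + d := by
    rw [ModularGroup.denom_apply]
    simp [hg, ht]
  refine ⟨hsmul ▸ (g • t).im_pos, ?_⟩
  have h := congrFun (EisensteinSeries.E2_slash_action g) t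
  rw [ModularForm.SL_slash_apply, hden, Pi.sub_apply, Pi.smul_apply, EisensteinSeries.D2, hden,
    ← E2_eq_eisensteinSeries, ← E2_eq_eisensteinSeries, hsmul, riemannZeta_two] at h
  have hc : (g 1 0 : ℤ) = c := by simp [hg]
  rw [hc, show ((t : UpperHalfPlane) : ℂ) = τ from rfl] at h
  have hπ : (Real.pi : ℂ) ≠ 0 := by exact_mod_cast Real.pi_ne_zero
  rw [zpow_neg, ← div_eq_mul_inv, div_eq_iff (zpow_ne_zero _ hj)] at h
  rw [h]
  have hInv : (2 * (Real.pi : ℂ) * Complex.I)⁻¹ = -Complex.I / (2 * Real.pi) := by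
    rw [mul_inv, Complex.inv_I]
    field_simp
  rw [hInv, zpow_ofNat, smul_eq_mul]
  field_simp
  ring

lemma div_denom_add (hdet : a * d - b * c = 1) (hj : (c : ℂ) * τ + d ≠ 0) (z : ℂ) (l n : ℤ) :
    (z + l * τ + n) / ((c : ℂ) * τ + d) = z / (c * τ + d) +
      ((l * d - n * c : ℤ) : ℂ) * (((a : ℂ) * τ + b) / (c * τ + d)) +
      ((n * a - l * b : ℤ) : ℂ) := by
  have hdet' : (a : ℂ) * d - b * c = 1 := by exact_mod_cast hdet
  push_cast
  generalize hjdef : (c : ℂ) * τ + d = j at hj ⊢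
  field_simp
  rw [← hjdef]
  linear_combination (-(l : ℂ) * τ - n) * hdet'

lemma OffLattice.div_denom (hj : (c : ℂ) * τ + d ≠ 0) {z : ℂ}
    (hz : OffLattice τ z) :
    OffLattice (((a : ℂ) * τ + b) / (c * τ + d)) (z / (c * τ + d)) := by
  intro l n h
  apply hz (l * a + n * c) (l * b + n * d)
  field_simp at h
  rw [h]
  push_cast
  ring

lemma tendsto_div_denom (hj : (c : ℂ) * τ + d ≠ 0) :
    Tendsto (fun z : ℂ => z / ((c : ℂ) * τ + d)) (𝓝[≠] 0) (𝓝[≠] 0) := by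
  refine tendsto_nhdsWithin_iff.2 ⟨?_, ?_⟩
  · have h : Continuous fun z : ℂ => z / ((c : ℂ) * τ + d) := by fun_prop
    exact (h.tendsto' 0 0 (zero_div _)).mono_left nhdsWithin_le_nhds
  · filter_upwards [self_mem_nhdsWithin] with z hz
    exact div_ne_zero hz hj

lemma tendsto_mul_J1Ext_div_denom (hdet : a * d - b * c = 1) (hτ : 0 < τ.im) :
    Tendsto (fun z => z * J1Ext (((a : ℂ) * τ + b) / (c * τ + d)) (z / (c * τ + d))) (𝓝[≠] 0)
      (𝓝 ((c * τ + d) * (2 * (Real.pi : ℂ) * Complex.I)⁻¹)) := by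
  have hj := denom_ne_zero hdet hτ
  have h := (((tendsto_mul_J1Ext (E2_moebius hdet hτ).1).comp
    (tendsto_div_denom hj)).const_mul ((c : ℂ) * τ + d))
  refine h.congr fun z => ?_
  simp only [Function.comp_apply]
  rw [← mul_assoc, mul_div_cancel₀ _ hj]

lemma tendsto_id_punctured : Tendsto (fun z : ℂ => z) (𝓝[≠] 0) (𝓝 0) :=
  tendsto_id.mono_left nhdsWithin_le_nhds

lemma J1Ext_moebius (hdet : a * d - b * c = 1) (hτ : 0 < τ.im) {z : ℂ} (hz : OffLattice τ z) :
    J1Ext (((a : ℂ) * τ + b) / (c * τ + d)) (z / (c * τ + d)) =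
      (c * τ + d) * J1Ext τ z + c * z := by
  have hj := denom_ne_zero hdet hτ
  have hτ' := (E2_moebius hdet hτ).1
  set j : ℂ := (c : ℂ) * τ + d with hjdef
  set τ' : ℂ := ((a : ℂ) * τ + b) / j
  set h : ℂ → ℂ := fun z => J1Ext τ' (z / j) - j * J1Ext τ z - c * z with hh
  have hd : ∀ z, OffLattice τ z → DifferentiableAt ℂ h z := by
    intro z hz
    have h1 := differentiableAt_J1Ext hτ hz
    have h2 : DifferentiableAt ℂ (fun z => J1Ext τ' (z / j)) z :=
      DifferentiableAt.comp z (f := fun z => z / j)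
        (differentiableAt_J1Ext hτ' (hz.div_denom hj)) (by fun_prop)
    fun_prop
  have hp : ∀ z, OffLattice τ z → ∀ l n : ℤ, h (z + l * τ + n) = h z := by
    intro z hz l n
    simp only [hh]
    rw [(J_ext_add_lattice hτ l n hz).1, div_denom_add hdet hj,
      (J_ext_add_lattice hτ' _ _ (hz.div_denom hj)).1]
    push_cast
    rw [hjdef]
    ring
  have h0 : Tendsto (fun z => z * h z) (𝓝[≠] 0) (𝓝 0) := by
    have h1 := (tendsto_mul_J1Ext_div_denom hdet hτ).sub ((tendsto_mul_J1Ext hτ).const_mul j)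
    have h2 := h1.sub ((tendsto_id_punctured.pow 2).const_mul (c : ℂ))
    rw [sub_self] at h2
    norm_num at h2
    refine h2.congr fun z => ?_
    simp only [hh]
    ring
  obtain ⟨L, -, hL⟩ := eq_const_of_doublyPeriodic hτ hd hp h0
  have hneg : h (-z) = -h z := by
    simp only [hh, neg_div]
    rw [J1Ext_neg hz.e_ne_one, J1Ext_neg (hz.div_denom (a := a) (b := b) hj).e_ne_one]
    ring
  rw [hL _ hz.neg, hL _ hz] at hneg
  have hL0 : L = 0 := by linear_combination hneg / 2
  have h1 := hL z hz
  simp only [hh, hL0] at h1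
  linear_combination h1

lemma J2Ext_moebius (hdet : a * d - b * c = 1) (hτ : 0 < τ.im) {z : ℂ} (hz : OffLattice τ z) :
    J2Ext (((a : ℂ) * τ + b) / (c * τ + d)) (z / (c * τ + d)) =
      (c * τ + d) ^ 2 * J2Ext τ z + 2 * c * z * (c * τ + d) * J1Ext τ z + c ^ 2 * z ^ 2 := by
  have hj := denom_ne_zero hdet hτ
  obtain ⟨hτ', hE⟩ := E2_moebius hdet hτ
  set j : ℂ := (c : ℂ) * τ + d with hjdef
  set τ' : ℂ := ((a : ℂ) * τ + b) / j
  set h : ℂ → ℂ := fun z =>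
    J2Ext τ' (z / j) - j ^ 2 * J2Ext τ z - 2 * c * z * j * J1Ext τ z - c ^ 2 * z ^ 2 with hh
  have hlim : Tendsto h (𝓝[≠] 0) (𝓝 0) := by
    have h1 := ((tendsto_J2Ext_zero hτ').comp (tendsto_div_denom hj)).sub
      ((tendsto_J2Ext_zero hτ).const_mul (j ^ 2))
    have h2 := (h1.sub ((tendsto_mul_J1Ext hτ).const_mul (2 * c * j))).sub
      ((tendsto_id_punctured.pow 2).const_mul ((c : ℂ) ^ 2))
    have h3 : J2Ext τ' 0 - j ^ 2 * J2Ext τ 0 - 2 * c * j * (2 * (Real.pi : ℂ) * Complex.I)⁻¹ -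
        (c : ℂ) ^ 2 * 0 ^ 2 = 0 := by
      rw [J2Ext_zero hτ, J2Ext_zero hτ', hE]
      ring
    rw [h3] at h2
    refine h2.congr fun z => ?_
    simp only [hh, Function.comp_apply]
    ring
  have hd : ∀ z, OffLattice τ z → DifferentiableAt ℂ h z := by
    intro z hz
    have h1 := differentiableAt_J1Ext hτ hz
    have h3 := differentiableAt_J2Ext hτ hz
    have h2 : DifferentiableAt ℂ (fun z => J2Ext τ' (z / j)) z :=
      DifferentiableAt.comp z (f := fun z => z / j)
        (differentiableAt_J2Ext hτ' (hz.div_denom hj)) (by fun_prop)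
    fun_prop
  have hp : ∀ z, OffLattice τ z → ∀ l n : ℤ, h (z + l * τ + n) = h z := by
    intro z hz l n
    simp only [hh]
    rw [(J_ext_add_lattice hτ l n hz).1, (J_ext_add_lattice hτ l n hz).2, div_denom_add hdet hj,
      (J_ext_add_lattice hτ' _ _ (hz.div_denom hj)).2, J1Ext_moebius hdet hτ hz]
    push_cast
    rw [hjdef]
    ring
  have h0 : Tendsto (fun z => z * h z) (𝓝[≠] 0) (𝓝 0) := by
    simpa using tendsto_id_punctured.mul hlim
  obtain ⟨L, hL0, hL⟩ := eq_const_of_doublyPeriodic hτ hd hp h0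
  rw [tendsto_nhds_unique hL0 hlim] at hL
  have h1 := hL z hz
  simp only [hh] at h1
  linear_combination h1

end Modular

lemma hasDerivAt_e_comp {f : ℂ → ℂ} {f' x : ℂ} (hf : HasDerivAt f f' x) :
    HasDerivAt (fun x => e (f x)) (e (f x) * (2 * (Real.pi : ℂ) * Complex.I * f')) x := by
  have h := (hasDerivAt_e (f x)).comp x hf
  refine h.congr_deriv ?_
  ring

lemma Dz_eq {φ : ℂ → ℂ → ℂ} {τ z φ' : ℂ}
    (h : HasDerivAt (fun w => φ τ w) (2 * (Real.pi : ℂ) * Complex.I * φ') z) :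
    Dz φ τ z = φ' := by
  rw [Dz, h.deriv, one_div, inv_mul_cancel_left₀ Complex.two_pi_I_ne_zero]

lemma Dt_eq {φ : ℂ → ℂ → ℂ} {τ z φ' : ℂ}
    (h : HasDerivAt (fun t => φ t z) (2 * (Real.pi : ℂ) * Complex.I * φ') τ) :
    Dt φ τ z = φ' := by
  rw [Dt, h.deriv, one_div, inv_mul_cancel_left₀ Complex.two_pi_I_ne_zero]

lemma Dz_Qmon (n : ℕ) (r : ℤ) (τ z : ℂ) : Dz (Qmon n r) τ z = r * Qmon n r τ z := by
  refine Dz_eq ?_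
  refine (hasDerivAt_e_comp (((hasDerivAt_id z).const_mul (r : ℂ)).const_add _)).congr_deriv ?_
  simp only [Qmon, id]
  ring

lemma Dt_Qmon (n : ℕ) (r : ℤ) (τ z : ℂ) : Dt (Qmon n r) τ z = n * Qmon n r τ z := by
  refine Dt_eq ?_
  refine (hasDerivAt_e_comp (((hasDerivAt_id τ).const_mul (n : ℂ)).add_const _)).congr_deriv ?_
  simp only [Qmon, id]
  ring

section SlashMonomial

variable (k m : ℤ) (n : ℕ) (r a b c d lam mu : ℤ) {τ : ℂ} (z : ℂ)

lemma Dz_slash_Qmon :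
    Dz (slash k m a b c d lam mu (Qmon n r)) τ z =
      (m * (-2 * c * (z + lam * τ + mu) / (c * τ + d) + 2 * lam) + r / (c * τ + d)) *
        slash k m a b c d lam mu (Qmon n r) τ z := by
  refine Dz_eq ?_
  have h0 : HasDerivAt (fun w : ℂ => w + lam * τ + mu) 1 z :=
    ((hasDerivAt_id z).add_const _).add_const _
  have h1 := hasDerivAt_e_comp (((((h0.pow 2).const_mul (-(c : ℂ))).div_const
    ((c : ℂ) * τ + d)).add_const ((lam : ℂ) ^ 2 * τ)).add
    ((hasDerivAt_id z).const_mul (2 * (lam : ℂ))) |>.const_mul (m : ℂ))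
  have h2 := hasDerivAt_e_comp (((h0.div_const ((c : ℂ) * τ + d)).const_mul (r : ℂ)).const_add
    ((n : ℂ) * (((a : ℂ) * τ + b) / (c * τ + d))))
  refine ((h1.const_mul (((c : ℂ) * τ + d) ^ (-k))).mul h2).congr_deriv ?_
  simp only [slash, Qmon, id, Pi.add_apply, Pi.pow_apply]
  ring

lemma Dt_slash_Qmon (hdet : a * d - b * c = 1) (hj : (c : ℂ) * τ + d ≠ 0) :
    Dt (slash k m a b c d lam mu (Qmon n r)) τ z =
      (-k * c / (c * τ + d) * (2 * (Real.pi : ℂ) * Complex.I)⁻¹ +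
        m * (-2 * c * lam * (z + lam * τ + mu) / (c * τ + d) +
          c ^ 2 * (z + lam * τ + mu) ^ 2 / (c * τ + d) ^ 2 + lam ^ 2) + n / (c * τ + d) ^ 2 +
        r * (lam / (c * τ + d) - c * (z + lam * τ + mu) / (c * τ + d) ^ 2)) *
        slash k m a b c d lam mu (Qmon n r) τ z := by
  have hdet' : (a : ℂ) * d - b * c = 1 := by exact_mod_cast hdet
  have hP := Complex.two_pi_I_ne_zero
  refine Dt_eq ?_
  have h0 : HasDerivAt (fun t : ℂ => z + lam * t + mu) lam τ := by
    simpa using (((hasDerivAt_id τ).const_mul (lam : ℂ)).const_add z).add_const (mu : ℂ)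
  have h1 : HasDerivAt (fun t : ℂ => (c : ℂ) * t + d) c τ := by
    simpa using ((hasDerivAt_id τ).const_mul (c : ℂ)).add_const (d : ℂ)
  have h2 : HasDerivAt (fun t : ℂ => (a : ℂ) * t + b) a τ := by
    simpa using ((hasDerivAt_id τ).const_mul (a : ℂ)).add_const (b : ℂ)
  have h3 := (hasDerivAt_zpow (-k) _ (Or.inl hj)).comp τ h1
  have h4 := hasDerivAt_e_comp (((((h0.pow 2).const_mul (-(c : ℂ))).div h1 hj).add
    ((hasDerivAt_id τ).const_mul ((lam : ℂ) ^ 2))).add_const (2 * (lam : ℂ) * z)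
    |>.const_mul (m : ℂ))
  have h5 := hasDerivAt_e_comp (((h2.div h1 hj).const_mul (n : ℂ)).add
    ((h0.div h1 hj).const_mul (r : ℂ)))
  refine ((h3.mul h4).mul h5).congr_deriv ?_
  rw [zpow_sub_one₀ hj]
  simp only [slash, Qmon, id, Pi.add_apply, Pi.mul_apply, Pi.pow_apply, Pi.div_apply,
    Function.comp_apply]
  generalize e _ = A
  generalize e _ = B
  generalize ((c : ℂ) * τ + d) ^ (-k) = C
  generalize 2 * (Real.pi : ℂ) * Complex.I = P at hP ⊢
  have ha : (a : ℂ) * ((c : ℂ) * τ + d) - (a * τ + b) * c = 1 := by linear_combination hdet'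
  rw [ha]
  generalize z + (lam : ℂ) * τ + mu = y
  generalize (c : ℂ) * τ + d = j at hj ⊢
  push_cast
  field_simp
  ring

end SlashMonomial

/-- the Oberdieck derivative commutes with the slash action on monomials,
on points of `D'` whose image also lies in `D'`. -/
theorem statement2 (k m n : ℕ) (hk : 0 < k) (hm : 0 < m) (hn : 0 < n) (r : ℤ)
    (a b c d lam mu : ℤ) (hdet : a * d - b * c = 1) (τ z : ℂ)
    (hmem : (τ, z) ∈ D')
    (hmem' : (((a : ℂ) * τ + (b : ℂ)) / ((c : ℂ) * τ + (d : ℂ)),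
      (z + (lam : ℂ) * τ + (mu : ℂ)) / ((c : ℂ) * τ + (d : ℂ))) ∈ D') :
    slash ((k : ℤ) + 2) (m : ℤ) a b c d lam mu (Ober k m (Qmon n r)) τ z
      = Ober k m (slash (k : ℤ) (m : ℤ) a b c d lam mu (Qmon n r)) τ z := by
  have hτ : 0 < τ.im := hmem.1
  have hj := denom_ne_zero hdet hτ
  have hz := offLattice_of_mem hmem
  have hz' := hz.add lam mu
  obtain ⟨h1, h2⟩ := J_ext_add_lattice hτ lam mu hz
  have hJ1 : J1 _ _ = _ := J1_eq_J1Ext hmem'.2.1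
  have hJ2 : J2 _ _ = _ := J2_eq_J2Ext hmem'.2.1
  rw [J1Ext_moebius hdet hτ hz', h1] at hJ1
  rw [J2Ext_moebius hdet hτ hz', h1, h2] at hJ2
  simp only [Ober]
  rw [Dt_slash_Qmon k m n r a b c d lam mu z hdet hj, Dz_slash_Qmon k m n r a b c d lam mu z,
    J1_eq_J1Ext hmem.2.1, J2_eq_J2Ext hmem.2.1]
  simp only [slash, Ober]
  rw [Dt_Qmon, Dz_Qmon, hJ1, hJ2, (E2_moebius hdet hτ).2, neg_add, zpow_add₀ hj, zpow_neg _ 2,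
    zpow_ofNat]
  generalize e _ = A
  generalize Qmon _ _ _ _ = B
  generalize ((c : ℂ) * τ + d) ^ (-(k : ℤ)) = C
  generalize (2 * (Real.pi : ℂ) * Complex.I)⁻¹ = P
  generalize z + (lam : ℂ) * τ + mu = y
  generalize (c : ℂ) * τ + d = j at hj ⊢
  push_cast
  field_simp
  ring
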